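/- Let B'' ⊆ B' ⊆ B be subdiagrams of a diagram D. The map (H, H') ↦ H ∪ H' from Ns(B,B') × Ns(B',B'') to Ns(B,B'') is well defined and injective, its image is exactly the set of nested sets on B relative to B'' which contain every connected component of B', and it sends pairs of maximal relative nested sets to maximal relative nested sets. -/

import Mathlib

/-- Two subdiagrams of a diagram `G` are *orthogonal* if they are disjoint and no edge of
`G` joins a vertex of one to a vertex of the other. -/
def Diagram.Orthogonal {V : Type*} (G : SimpleGraph V) (B₁ B₂ : Finset V) : Prop :=
  Disjoint B₁ B₂ ∧ ∀ i ∈ B₁, ∀ j ∈ B₂, ¬ G.Adj i j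

/-- Two subdiagrams are *compatible* if one contains the other or they are orthogonal. -/
def Diagram.Compatible {V : Type*} (G : SimpleGraph V) (B₁ B₂ : Finset V) : Prop :=
  B₁ ⊆ B₂ ∨ B₂ ⊆ B₁ ∨ Diagram.Orthogonal G B₁ B₂

/-- A subdiagram is *connected* if the induced subgraph is connected. -/
def Diagram.IsConnSub {V : Type*} (G : SimpleGraph V) (C : Finset V) : Prop :=
  (G.induce (C : Set V)).Connected

/-- `C` is a connected component of the subdiagram `B`. -/
def Diagram.IsCC {V : Type*} (G : SimpleGraph V) (B C : Finset V) : Prop :=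
  C ⊆ B ∧ Diagram.IsConnSub G C ∧
    ∀ C' : Finset V, C ⊆ C' → C' ⊆ B → Diagram.IsConnSub G C' → C' = C

/-- A *nested set on `B` relative to `B'`* (an element of `Ns(B,B')`): a collection of
pairwise compatible connected subdiagrams of `B` which contains every connected component
of `B` and of `B'`, and each of whose elements is compatible with, and not properly
contained in, any connected component of `B'`. -/
def Diagram.IsRelNested {V : Type*} (G : SimpleGraph V) (B B' : Finset V)
    (H : Finset (Finset V)) : Prop :=
  (∀ C ∈ H, C ⊆ B ∧ Diagram.IsConnSub G C) ∧
  (∀ C₁ ∈ H, ∀ C₂ ∈ H, Diagram.Compatible G C₁ C₂) ∧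
  (∀ C : Finset V, Diagram.IsCC G B C → C ∈ H) ∧
  (∀ C : Finset V, Diagram.IsCC G B' C → C ∈ H) ∧
  (∀ C ∈ H, ∀ C' : Finset V, Diagram.IsCC G B' C' → Diagram.Compatible G C C' ∧ ¬ C ⊂ C')

/-- A *maximal* nested set on `B` relative to `B'`: one maximal with respect to inclusion
among relative nested sets. -/
def Diagram.IsMaxRelNested {V : Type*} (G : SimpleGraph V) (B B' : Finset V)
    (H : Finset (Finset V)) : Prop :=
  Diagram.IsRelNested G B B' H ∧
    ∀ H' : Finset (Finset V), Diagram.IsRelNested G B B' H' → H ⊆ H' → H' = H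

namespace Diagram

variable {V : Type*} {G : SimpleGraph V} {B B' B'' C C' K : Finset V}

lemma Orthogonal.symm (h : Orthogonal G C C') : Orthogonal G C' C :=
  ⟨h.1.symm, fun i hi j hj hij => h.2 j hj i hi hij.symm⟩

lemma Orthogonal.mono_right (h : Orthogonal G C K) (hK : C' ⊆ K) : Orthogonal G C C' :=
  ⟨h.1.mono_right hK, fun i hi j hj => h.2 i hi j (hK hj)⟩

lemma Compatible.symm (h : Compatible G C C') : Compatible G C' C := by
  rcases h with h | h | h
  · exact Or.inr (Or.inl h)
  · exact Or.inl h
  · exact Or.inr (Or.inr h.symm)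

/-- Compatibility passes to smaller subdiagrams of one not properly containing the other. -/
lemma Compatible.mono_right (h : Compatible G C K) (hn : ¬ C ⊂ K) (hK : C' ⊆ K) :
    Compatible G C C' := by
  rcases h with h | h | h
  · have hKC : K ⊆ C := by
      by_contra hKC
      exact hn ⟨h, hKC⟩
    exact Or.inr (Or.inl (hK.trans hKC))
  · exact Or.inr (Or.inl (hK.trans h))
  · exact Or.inr (Or.inr (h.mono_right hK))

/-- Every connected subdiagram of `B` lies in a connected component of `B`. -/
lemma IsConnSub.exists_isCC (hC : IsConnSub G C) (hCB : C ⊆ B) :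
    ∃ K, IsCC G B K ∧ C ⊆ K := by
  classical
  obtain ⟨K, hCK, hK⟩ := (B.powerset.filter (IsConnSub G)).exists_le_maximal
    (a := C) (by simp [hC, hCB])
  have hK' := hK.prop
  simp only [Finset.mem_filter, Finset.mem_powerset] at hK'
  refine ⟨K, ⟨hK'.1, hK'.2, fun L hKL hLB hL => ?_⟩, hCK⟩
  exact (hK.eq_of_le (by simp [hL, hLB]) hKL).symm

/-- A connected component of `B` is not properly contained in a connected component of a
subdiagram of `B`. -/
lemma IsCC.not_ssubset (hC : IsCC G B C) (hK : IsCC G B' K) (h : B' ⊆ B) : ¬ C ⊂ K :=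
  fun hCK => hCK.ne (hC.2.2 K hCK.subset (hK.1.trans h) hK.2.1).symm

variable [DecidableEq V] {H H' : Finset (Finset V)}

lemma IsRelNested.union (h1 : B'' ⊆ B') (h2 : B' ⊆ B) (hH : IsRelNested G B B' H)
    (hH' : IsRelNested G B' B'' H') : IsRelNested G B B'' (H ∪ H') := by
  obtain ⟨a1, a2, a3, a4, a5⟩ := hH
  obtain ⟨b1, b2, b3, b4, b5⟩ := hH'
  have mixed : ∀ C ∈ H, ∀ C' ∈ H', Compatible G C C' := by
    intro C hC C' hC'
    obtain ⟨K, hK, hCK⟩ := (b1 C' hC').2.exists_isCC (b1 C' hC').1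
    exact (a5 C hC K hK).1.mono_right (a5 C hC K hK).2 hCK
  refine ⟨fun C hC => ?_, fun C hC D hD => ?_, fun C hC => ?_, fun C hC => ?_,
    fun C hC C' hC' => ?_⟩
  · rcases Finset.mem_union.1 hC with hC | hC
    · exact a1 C hC
    · exact ⟨(b1 C hC).1.trans h2, (b1 C hC).2⟩
  · rcases Finset.mem_union.1 hC with hC | hC <;> rcases Finset.mem_union.1 hD with hD | hD
    · exact a2 C hC D hD
    · exact mixed C hC D hD
    · exact (mixed D hD C hC).symm
    · exact b2 C hC D hD
  · exact Finset.mem_union_left _ (a3 C hC)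
  · exact Finset.mem_union_right _ (b4 C hC)
  · rcases Finset.mem_union.1 hC with hC | hC
    · refine ⟨mixed C hC C' (b4 C' hC'), fun hlt => ?_⟩
      obtain ⟨K, hK, hCK⟩ := hC'.2.1.exists_isCC (hC'.1.trans h1)
      exact (a5 C hC K hK).2 (hlt.trans_subset hCK)
    · exact b5 C hC C' hC'

/-- The lower factor of a vertical union consists of its elements contained in `B'`. -/
lemma IsRelNested.mem_right_iff (hH : IsRelNested G B B' H) (hH' : IsRelNested G B' B'' H') :
    C ∈ H' ↔ C ∈ H ∪ H' ∧ C ⊆ B' := by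
  refine ⟨fun hC => ⟨Finset.mem_union_right _ hC, (hH'.1 C hC).1⟩, fun ⟨hC, hCB⟩ => ?_⟩
  rcases Finset.mem_union.1 hC with hC | hC
  · obtain ⟨K, hK, hCK⟩ := (hH.1 C hC).2.exists_isCC hCB
    rcases hCK.eq_or_ssubset with rfl | hlt
    · exact hH'.2.2.1 _ hK
    · exact absurd hlt (hH.2.2.2.2 C hC K hK).2
  · exact hC

/-- The upper factor of a vertical union consists of its elements which are not properly
contained in a connected component of `B'`. -/
lemma IsRelNested.mem_left_iff (hH : IsRelNested G B B' H) (hH' : IsRelNested G B' B'' H') :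
    C ∈ H ↔ C ∈ H ∪ H' ∧ ∀ K, IsCC G B' K → ¬ C ⊂ K := by
  refine ⟨fun hC => ⟨Finset.mem_union_left _ hC, fun K hK => (hH.2.2.2.2 C hC K hK).2⟩,
    fun ⟨hC, hCK⟩ => ?_⟩
  rcases Finset.mem_union.1 hC with hC | hC
  · exact hC
  · obtain ⟨K, hK, hle⟩ := (hH'.1 C hC).2.exists_isCC (hH'.1 C hC).1
    rcases hle.eq_or_ssubset with rfl | hlt
    · exact hH.2.2.2.1 _ hK
    · exact absurd hlt (hCK K hK)

/-- A nested set on `B` relative to `B''` which contains the connected components of `B'`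
is a vertical union. -/
lemma IsRelNested.exists_union_eq (h1 : B'' ⊆ B') (h2 : B' ⊆ B) {N : Finset (Finset V)}
    (hN : IsRelNested G B B'' N) (hcc : ∀ C, IsCC G B' C → C ∈ N) :
    ∃ H H', IsRelNested G B B' H ∧ IsRelNested G B' B'' H' ∧ H ∪ H' = N := by
  classical
  obtain ⟨a1, a2, a3, a4, a5⟩ := hN
  refine ⟨N.filter fun C => ∀ K, IsCC G B' K → ¬ C ⊂ K, N.filter (· ⊆ B'), ?_, ?_, ?_⟩
  · simp only [IsRelNested, Finset.mem_filter]
    exact ⟨fun C hC => a1 C hC.1, fun C hC D hD => a2 C hC.1 D hD.1,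
      fun C hC => ⟨a3 C hC, fun K hK => hC.not_ssubset hK h2⟩,
      fun C hC => ⟨hcc C hC, fun K hK => hC.not_ssubset hK subset_rfl⟩,
      fun C hC K hK => ⟨a2 C hC.1 K (hcc K hK), hC.2 K hK⟩⟩
  · simp only [IsRelNested, Finset.mem_filter]
    exact ⟨fun C hC => ⟨hC.2, (a1 C hC.1).2⟩, fun C hC D hD => a2 C hC.1 D hD.1,
      fun C hC => ⟨hcc C hC, hC.1⟩, fun C hC => ⟨a4 C hC, hC.1.trans h1⟩,
      fun C hC K hK => a5 C hC.1 K hK⟩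
  · ext C
    simp only [Finset.mem_union, Finset.mem_filter]
    refine ⟨fun h => h.elim And.left And.left, fun hC => ?_⟩
    by_cases h : ∀ K, IsCC G B' K → ¬ C ⊂ K
    · exact Or.inl ⟨hC, h⟩
    · push Not at h
      obtain ⟨K, hK, hlt⟩ := h
      exact Or.inr ⟨hC, hlt.subset.trans hK.1⟩

lemma IsMaxRelNested.union (h1 : B'' ⊆ B') (h2 : B' ⊆ B) (hH : IsMaxRelNested G B B' H)
    (hH' : IsMaxRelNested G B' B'' H') : IsMaxRelNested G B B'' (H ∪ H') := by
  refine ⟨hH.1.union h1 h2 hH'.1, fun N hN hle => ?_⟩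
  obtain ⟨L, L', hL, hL', rfl⟩ := hN.exists_union_eq h1 h2
    fun C hC => hle (Finset.mem_union_left _ (hH.1.2.2.2.1 C hC))
  have e : L = H := hH.2 L hL fun C hC => (hL.mem_left_iff hL').2
    ⟨hle (Finset.mem_union_left _ hC), ((hH.1.mem_left_iff hH'.1).1 hC).2⟩
  have e' : L' = H' := hH'.2 L' hL' fun C hC => (hL.mem_right_iff hL').2
    ⟨hle (Finset.mem_union_right _ hC), ((hH.1.mem_right_iff hH'.1).1 hC).2⟩
  rw [e, e']

end Diagram

/-- **Vertical union of relative nested sets.**  Let `B'' ⊆ B' ⊆ B` be subdiagrams of a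
diagram.  The map `(H, H') ↦ H ∪ H'` from `Ns(B,B') × Ns(B',B'')` to `Ns(B,B'')` is well
defined and injective, its image is exactly the set of nested sets on `B` relative to
`B''` which contain every connected component of `B'`, and it sends pairs of maximal
relative nested sets to maximal relative nested sets. -/
theorem relNested_vertical_union {V : Type*} [DecidableEq V] (G : SimpleGraph V)
    (B B' B'' : Finset V) (h1 : B'' ⊆ B') (h2 : B' ⊆ B) :
    (∀ H H' : Finset (Finset V), Diagram.IsRelNested G B B' H →
        Diagram.IsRelNested G B' B'' H' → Diagram.IsRelNested G B B'' (H ∪ H')) ∧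
    Set.InjOn (fun p : Finset (Finset V) × Finset (Finset V) => p.1 ∪ p.2)
      {p | Diagram.IsRelNested G B B' p.1 ∧ Diagram.IsRelNested G B' B'' p.2} ∧
    ((fun p : Finset (Finset V) × Finset (Finset V) => p.1 ∪ p.2) ''
        {p | Diagram.IsRelNested G B B' p.1 ∧ Diagram.IsRelNested G B' B'' p.2} =
      {K | Diagram.IsRelNested G B B'' K ∧
        ∀ C : Finset V, Diagram.IsCC G B' C → C ∈ K}) ∧
    (∀ H H' : Finset (Finset V), Diagram.IsMaxRelNested G B B' H →
        Diagram.IsMaxRelNested G B' B'' H' → Diagram.IsMaxRelNested G B B'' (H ∪ H')) := by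
  refine ⟨fun H H' hH hH' => hH.union h1 h2 hH', ?_, ?_,
    fun H H' hH hH' => hH.union h1 h2 hH'⟩
  · rintro ⟨H, H'⟩ ⟨hH, hH'⟩ ⟨L, L'⟩ ⟨hL, hL'⟩ (heq : H ∪ H' = L ∪ L')
    refine Prod.ext (Finset.ext fun C => ?_) (Finset.ext fun C => ?_)
    · exact (hH.mem_left_iff hH').trans (heq ▸ (hL.mem_left_iff hL').symm)
    · exact (hH.mem_right_iff hH').trans (heq ▸ (hL.mem_right_iff hL').symm)
  · ext N
    constructor
    · rintro ⟨⟨H, H'⟩, ⟨hH, hH'⟩, rfl⟩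
      exact ⟨hH.union h1 h2 hH', fun C hC => Finset.mem_union_left _ (hH.2.2.2.1 C hC)⟩
    · rintro ⟨hN, hcc⟩
      obtain ⟨H, H', hH, hH', hu⟩ := hN.exists_union_eq h1 h2 hcc
      exact ⟨(H, H'), ⟨hH, hH'⟩, hu⟩
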